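/- The splitting field of the polynomial x^6 - 3x^2 + 6 over Q contains the quadratic field Q(\sqrt{-6}). -/

import Mathlib

open Polynomial

/-- If `X⁶ - 3X² + 6` splits in a field, the product of one root from each pair `±r` is a square
root of `-6`. -/
theorem exists_sq_eq_neg_six_of_splits {L : Type*} [Field L]
    (h : (X ^ 6 - 3 * X ^ 2 + 6 : L[X]).Splits) : ∃ z : L, z ^ 2 = -6 := by
  have h₀ : (X ^ 6 - 3 * X ^ 2 + 6 : L[X]) ≠ 0 := by
    refine Monic.ne_zero ?_
    monicity!
  obtain ⟨a, ha⟩ := h.exists_eval_eq_zero (by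
    have : (X ^ 6 - 3 * X ^ 2 + 6 : L[X]).degree = 6 := by compute_degree!
    simp [this])
  have ha' : a ^ 6 - 3 * a ^ 2 + 6 = 0 := by simpa using ha
  have hC : (C a ^ 6 - 3 * C a ^ 2 + 6 : L[X]) = 0 := by
    simpa [map_ofNat (C : L →+* L[X])] using congrArg (C : L →+* L[X]) ha'
  have hq : (X ^ 4 + C a ^ 2 * X ^ 2 + (C a ^ 4 - 3) : L[X]).Splits :=
    h.of_dvd h₀ ⟨X ^ 2 - C a ^ 2, by linear_combination hC⟩
  obtain ⟨b, hb⟩ := hq.exists_eval_eq_zero (by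
    have : (X ^ 4 + C a ^ 2 * X ^ 2 + (C a ^ 4 - 3) : L[X]).degree = 4 := by
      simp only [← C_pow]
      compute_degree!
    simp [this])
  have hb' : b ^ 4 + a ^ 2 * b ^ 2 + (a ^ 4 - 3) = 0 := by simpa using hb
  have hbC : (C b ^ 4 + C a ^ 2 * C b ^ 2 + (C a ^ 4 - 3) : L[X]) = 0 := by
    simpa [map_ofNat (C : L →+* L[X])] using congrArg (C : L →+* L[X]) hb'
  have hr : (X ^ 2 + (C a ^ 2 + C b ^ 2) : L[X]).Splits :=
    h.of_dvd h₀ ⟨(X ^ 2 - C a ^ 2) * (X ^ 2 - C b ^ 2), by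
      linear_combination hC + (X ^ 2 - C a ^ 2) * hbC⟩
  obtain ⟨c, hc⟩ := hr.exists_eval_eq_zero (by
    have : (X ^ 2 + (C a ^ 2 + C b ^ 2) : L[X]).degree = 2 := by
      simp only [← C_pow]
      compute_degree!
    simp [this])
  have hc' : c ^ 2 + (a ^ 2 + b ^ 2) = 0 := by simpa using hc
  exact ⟨a * b * c, by linear_combination a ^ 2 * b ^ 2 * hc' - a ^ 2 * hb' + ha'⟩

/-- The splitting field of `x⁶ - 3x² + 6` over `ℚ` contains `ℚ(√-6)`:
it has an element whose square is `-6`. -/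
theorem splitting_field_contains_sqrt_neg_six :
    ∃ z : (X ^ 6 - 3 * X ^ 2 + 6 : ℚ[X]).SplittingField, z ^ 2 = -6 := by
  have h := SplittingField.splits (X ^ 6 - 3 * X ^ 2 + 6 : ℚ[X])
  rw [Polynomial.map_add, Polynomial.map_sub, Polynomial.map_mul, Polynomial.map_pow,
    Polynomial.map_pow, map_X, Polynomial.map_ofNat, Polynomial.map_ofNat] at h
  exact exists_sq_eq_neg_six_of_splits h
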